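/- arXiv:1409.8537 — 5 statements merged into one kernel-verified Lean document; each statement's English description precedes it below -/
import Mathlib

section
/- Let E be a finite-dimensional real normed vector space, X an arbitrary set, and h : E → X a function. Suppose h is homogeneous with respect to two distinct points a, b ∈ E. Then h is invariant under every translation parallel to b − a: for every real number s and every x ∈ E one has h(x + s•(b − a)) = h(x). -/
/-- A function `h : E → X` is *homogeneous with respect to the point `a`* if it is constant
on open rays emanating from `a`.  If `h` is homogeneous with respect to two distinct points
`a ≠ b`, then `h` is invariant under every translation parallel to `b - a`. -/
theorem homogeneous_wrt_two_points_implies_translation_invariant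
    {E : Type*} [NormedAddCommGroup E] [NormedSpace ℝ E] [FiniteDimensional ℝ E]
    {X : Type*} (h : E → X) (a b : E) (hab : a ≠ b)
    (ha : ∀ t : ℝ, 0 < t → ∀ x : E, h (a + t • (x - a)) = h x)
    (hb : ∀ t : ℝ, 0 < t → ∀ x : E, h (b + t • (x - b)) = h x) :
    ∀ (s : ℝ) (x : E), h (x + s • (b - a)) = h x := by
  have key : ∀ s : ℝ, s < 1 → ∀ x : E, h (x + s • (b - a)) = h x := by
    intro s hs x
    have hpos : 0 < 1 - s := sub_pos.mpr hs
    have hx : x + s • (b - a) = b + (1 - s) • (a + (1 - s)⁻¹ • (x - a) - b) := by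
      match_scalars <;> field_simp <;> ring
    rw [hx, hb _ hpos, ha _ (inv_pos.mpr hpos)]
  intro s x
  rcases lt_or_ge s 1 with hs | hs
  · exact key s hs x
  · simpa using (key (-s) (by linarith) (x + s • (b - a))).symm
end

section
/- Let E be a finite-dimensional real normed vector space, X an arbitrary set, and h : E → X a function. Suppose h is homogeneous with respect to each of the points x₀, x₁, …, x_k ∈ E. Then for every vector v in the linear span of {x₁ − x₀, …, x_k − x₀} and every x ∈ E one has h(x + v) = h(x); in particular, h is homogeneous with respect to x₀ and invariant with respect to the affine subspace spanned by x₀, …, x_k. -/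
/-- A function homogeneous with respect to two points is invariant under translations along the
line joining them: dilations with inverse ratios about the two points compose to a translation. -/
theorem apply_add_smul_sub_of_homogeneous
    {E X : Type*} [AddCommGroup E] [Module ℝ E] {h : E → X} {a b : E}
    (ha : ∀ t : ℝ, 0 < t → ∀ x : E, h (a + t • (x - a)) = h x)
    (hb : ∀ t : ℝ, 0 < t → ∀ x : E, h (b + t • (x - b)) = h x)
    (c : ℝ) (x : E) : h (x + c • (b - a)) = h x := by
  have key : ∀ c : ℝ, c < 1 → ∀ x : E, h (x + c • (b - a)) = h x := by
    intro c hc x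
    have hpos : 0 < 1 - c := sub_pos.2 hc
    rw [← ha (1 - c)⁻¹ (inv_pos.2 hpos) x, ← hb (1 - c) hpos (a + (1 - c)⁻¹ • (x - a))]
    congr 1
    have hne : 1 - c ≠ 0 := hpos.ne'
    rw [add_sub_right_comm, smul_add, smul_inv_smul₀ hne]
    module
  rcases lt_or_ge c 1 with hc | hc
  · exact key c hc x
  · simpa using (key (-c) (by linarith) (x + c • (b - a))).symm


/-- If `h : E → X` is homogeneous with respect to each of the points `x₀, x₁, …, x_k`
(i.e. constant on open rays emanating from each of these points), then `h` is invariant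
under translation by every vector in the linear span of `{x₁ - x₀, …, x_k - x₀}`;
in particular `h` is symmetric with respect to the affine subspace spanned by the
points `x₀, …, x_k`. -/
theorem homogeneous_wrt_points_implies_span_invariant
    {E : Type*} [NormedAddCommGroup E] [NormedSpace ℝ E] [FiniteDimensional ℝ E]
    {X : Type*} (h : E → X) (k : ℕ) (pts : Fin (k + 1) → E)
    (hhom : ∀ i : Fin (k + 1), ∀ t : ℝ, 0 < t → ∀ x : E,
      h (pts i + t • (x - pts i)) = h x) :
    ∀ v ∈ Submodule.span ℝ (Set.range fun i : Fin k => pts i.succ - pts 0),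
      ∀ x : E, h (x + v) = h x := by
  intro v hv
  induction hv using Submodule.closure_induction with
  | zero => simp
  | add u v _ _ hu hv =>
    intro x
    rw [← add_assoc, hv, hu]
  | smul_mem c v hv =>
    obtain ⟨i, rfl⟩ := hv
    exact apply_add_smul_sub_of_homogeneous (hhom 0) (hhom i.succ) c
end

section
/- Let m ≥ 1 be an integer, p ∈ (0, m], and ε, Λ > 0. Let (μ_i) be a sequence of Borel measures on ℝ^m with μ_i(B₂(0)) ≤ Λ for every i. Define the concentration set Σ = { x in the closed unit ball of ℝ^m : for every r ∈ (0,1), liminf_{i→∞} r^{p−m} μ_i(B_r(x)) > ε }. Then there exists a constant C = C(m, p) such that for every r ∈ (0,1), the Lebesgue measure of the open r-neighborhood of Σ satisfies Vol(B_r(Σ)) ≤ C (Λ/ε) r^p. In particular Σ has bounded (m−p)-dimensional Minkowski content. -/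
open MeasureTheory

/-- If the pairwise disjoint families of `r`-balls centred in `A` have at most `N` members, then
the `r`-neighbourhood of `A` is covered by `N` balls of radius `3 * r`. -/
theorem exists_thickening_subset_iUnion_ball_of_card_le {X : Type*} [PseudoMetricSpace X]
    {A : Set X} {r : ℝ} (hr : 0 < r) {N : ℕ}
    (hN : ∀ F : Finset X, (F : Set X) ⊆ A →
      (F : Set X).PairwiseDisjoint (fun x => Metric.ball x r) → F.card ≤ N) :
    ∃ F : Finset X, (F : Set X) ⊆ A ∧ (F : Set X).PairwiseDisjoint (fun x => Metric.ball x r) ∧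
      Metric.thickening r A ⊆ ⋃ x ∈ F, Metric.ball x (3 * r) := by
  classical
  let S : Set ℕ := {n | ∃ F : Finset X, (F : Set X) ⊆ A ∧
    (F : Set X).PairwiseDisjoint (fun x => Metric.ball x r) ∧ F.card = n}
  have hbdd : BddAbove S := by
    refine ⟨N, ?_⟩
    rintro n ⟨F, hFA, hF, rfl⟩
    exact hN F hFA hF
  have hne : S.Nonempty := ⟨0, ∅, by simp, by simp, by simp⟩
  obtain ⟨F, hFA, hF, hcard⟩ := Nat.sSup_mem hne hbdd
  refine ⟨F, hFA, hF, fun y hy => ?_⟩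
  obtain ⟨x, hxA, hyx⟩ := Metric.mem_thickening_iff.1 hy
  obtain ⟨z, hz, hxz⟩ : ∃ z ∈ F, dist x z < 2 * r := by
    by_contra! h
    have hx : x ∉ F := fun hx => by
      have := h x hx
      rw [dist_self] at this
      linarith
    have hle := le_csSup hbdd (show (insert x F).card ∈ S from
      ⟨insert x F, by
        rw [Finset.coe_insert]
        exact Set.insert_subset hxA hFA, by
        rw [Finset.coe_insert]
        exact hF.insert fun z hz _ => Metric.ball_disjoint_ball (by linarith [h z hz]), rfl⟩)
    rw [Finset.card_insert_of_notMem hx] at hle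
    omega
  refine Set.mem_biUnion (x := z) hz ?_
  rw [Metric.mem_ball]
  linarith [dist_triangle y x z]

/-- If `μ` has mass at most `M` on `B` and mass more than `c` on every member of a finite family of
disjoint `r`-balls inside `B`, then the family has at most `M / c` members. -/
theorem card_mul_le_of_pairwiseDisjoint_ball {X : Type*} [PseudoMetricSpace X] [MeasurableSpace X]
    [OpensMeasurableSpace X] {μ : Measure X} {B : Set X} {M c r : ℝ} (hM : 0 ≤ M)
    (hμ : μ B ≤ ENNReal.ofReal M) {F : Finset X}
    (hF : (F : Set X).PairwiseDisjoint (fun x => Metric.ball x r))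
    (hB : ∀ x ∈ F, Metric.ball x r ⊆ B) (hc : ∀ x ∈ F, c ≤ (μ (Metric.ball x r)).toReal) :
    F.card * c ≤ M := by
  have hsum : ∑ x ∈ F, μ (Metric.ball x r) ≤ ENNReal.ofReal M := by
    rw [← measure_biUnion_finset hF fun x _ => Metric.isOpen_ball.measurableSet]
    exact (measure_mono (Set.iUnion₂_subset hB)).trans hμ
  have hfin : ∀ x ∈ F, μ (Metric.ball x r) ≠ ⊤ := fun x hx =>
    (((measure_mono (hB x hx)).trans hμ).trans_lt ENNReal.ofReal_lt_top).ne
  calc F.card * c ≤ ∑ x ∈ F, (μ (Metric.ball x r)).toReal := by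
        simpa using F.card_nsmul_le_sum _ c hc
    _ = (∑ x ∈ F, μ (Metric.ball x r)).toReal := (ENNReal.toReal_sum hfin).symm
    _ ≤ M := ENNReal.toReal_le_of_le_ofReal hM hsum

/-- Minkowski content bound for the concentration set of a sequence of measures with
uniformly bounded mass: if `μ_i(B₂(0)) ≤ Λ` and
`Σ = {x ∈ B̄₁(0) : ∀ r ∈ (0,1), liminf_i r^{p-m} μ_i(B_r(x)) > ε}`, then there is a
constant `C = C(m,p)` with `Vol(B_r(Σ)) ≤ C (Λ/ε) r^p` for all `r ∈ (0,1)`. -/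
theorem concentration_set_minkowski_bound
    (m : ℕ) (hm : 1 ≤ m) (p : ℝ) (hp0 : 0 < p) (hpm : p ≤ (m : ℝ)) :
    ∃ C : ℝ, 0 < C ∧
      ∀ (ε Λ : ℝ), 0 < ε → 0 < Λ →
        ∀ μ : ℕ → Measure (EuclideanSpace ℝ (Fin m)),
          (∀ i, μ i (Metric.ball (0 : EuclideanSpace ℝ (Fin m)) 2) ≤ ENNReal.ofReal Λ) →
          ∀ r ∈ Set.Ioo (0 : ℝ) 1,
            volume (Metric.thickening r
              {x : EuclideanSpace ℝ (Fin m) |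
                x ∈ Metric.closedBall (0 : EuclideanSpace ℝ (Fin m)) 1 ∧
                ∀ s ∈ Set.Ioo (0 : ℝ) 1,
                  ε < Filter.liminf
                    (fun i => s ^ (p - (m : ℝ)) * (μ i (Metric.ball x s)).toReal)
                    Filter.atTop})
            ≤ ENNReal.ofReal (C * (Λ / ε) * r ^ p) := by
  set ω : ENNReal := volume (Metric.ball (0 : EuclideanSpace ℝ (Fin m)) 1)
  have hωtop : ω ≠ ⊤ := measure_ball_lt_top.ne
  have hωpos : 0 < ω.toReal :=
    ENNReal.toReal_pos (Metric.measure_ball_pos _ _ one_pos).ne' hωtop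
  refine ⟨3 ^ m * ω.toReal, by positivity, fun ε Λ hε hΛ μ hμ r hr => ?_⟩
  have hr0 : 0 < r := hr.1
  set A := {x : EuclideanSpace ℝ (Fin m) | x ∈ Metric.closedBall 0 1 ∧
    ∀ s ∈ Set.Ioo (0 : ℝ) 1, ε < Filter.liminf
      (fun i => s ^ (p - (m : ℝ)) * (μ i (Metric.ball x s)).toReal) Filter.atTop}
  set q : ℝ := r ^ (p - (m : ℝ)) with hq
  have hqpos : 0 < q := Real.rpow_pos_of_pos hr0 _
  have hcard : ∀ F : Finset (EuclideanSpace ℝ (Fin m)), (F : Set (EuclideanSpace ℝ (Fin m))) ⊆ A →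
      (F : Set (EuclideanSpace ℝ (Fin m))).PairwiseDisjoint (fun x => Metric.ball x r) →
      (F.card : ℝ) ≤ Λ / ε * q := by
    intro F hFA hF
    have hev : ∀ᶠ i in Filter.atTop, ∀ x ∈ F, ε < q * (μ i (Metric.ball x r)).toReal := by
      rw [Filter.eventually_all_finset]
      exact fun x hx => Filter.eventually_lt_of_lt_liminf ((hFA hx).2 r hr)
        (Filter.isBoundedUnder_of ⟨0, fun i => by positivity⟩)
    obtain ⟨i, hi⟩ := hev.exists
    have key := card_mul_le_of_pairwiseDisjoint_ball (c := ε / q) hΛ.le (hμ i) hF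
      (fun x hx => Metric.ball_subset_ball' (by
        linarith [Metric.mem_closedBall.1 (hFA hx).1, hr.2]))
      (fun x hx => by
        rw [div_le_iff₀' hqpos]
        exact (hi x hx).le)
    rw [div_mul_eq_mul_div, le_div_iff₀ hε]
    rwa [mul_div_assoc', div_le_iff₀ hqpos] at key
  obtain ⟨F, hFA, hF, hcover⟩ := exists_thickening_subset_iUnion_ball_of_card_le hr0
    (fun F hFA hF => Nat.le_floor (hcard F hFA hF))
  have hvol : ∀ x : EuclideanSpace ℝ (Fin m),
      volume (Metric.ball x (3 * r)) = ENNReal.ofReal ((3 * r) ^ m * ω.toReal) := by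
    intro x
    rw [Measure.addHaar_ball_of_pos volume x (by positivity), finrank_euclideanSpace_fin,
      ENNReal.ofReal_mul (by positivity), ENNReal.ofReal_toReal hωtop]
  calc volume (Metric.thickening r A)
      ≤ ∑ x ∈ F, volume (Metric.ball x (3 * r)) :=
        (measure_mono hcover).trans (measure_biUnion_finset_le _ _)
    _ = ENNReal.ofReal (F.card * ((3 * r) ^ m * ω.toReal)) := by
        rw [Finset.sum_congr rfl fun x _ => hvol x, Finset.sum_const, nsmul_eq_mul,
          ENNReal.ofReal_mul F.card.cast_nonneg, ENNReal.ofReal_natCast]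
    _ ≤ ENNReal.ofReal (3 ^ m * ω.toReal * (Λ / ε) * r ^ p) := by
        refine ENNReal.ofReal_le_ofReal ?_
        have hrp : r ^ p = q * r ^ m := by
          rw [hq, ← Real.rpow_natCast, ← Real.rpow_add hr0, sub_add_cancel]
        calc F.card * ((3 * r) ^ m * ω.toReal)
            ≤ Λ / ε * q * ((3 * r) ^ m * ω.toReal) := by
              gcongr
              exact hcard F hFA hF
          _ = 3 ^ m * ω.toReal * (Λ / ε) * r ^ p := by rw [hrp, mul_pow]; ring
end

section
/- Let m ≥ 1 be an integer and p ≤ m a real number, and let ε > 0. Let (μ_i) be a sequence of finite Borel measures on ℝ^m converging weakly to a finite Borel measure μ, in the sense that ∫ φ dμ_i → ∫ φ dμ for every bounded continuous function φ : ℝ^m → ℝ. Let (x_i) be a sequence in ℝ^m converging to x. Suppose that r^{p−m} μ_i(B_r(x_i)) > ε for every i and every r ∈ (0,1). Then r^{p−m} μ(B_r(x)) ≥ ε for every r ∈ (0,1). -/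
open MeasureTheory

open Filter Topology BoundedContinuousFunction in
/-- A lower bound on the mass of a closed set passes to weak limits of finite measures. -/
theorem le_measure_isClosed_of_forall_tendsto_integral {Ω ι : Type*} [MeasurableSpace Ω]
    [TopologicalSpace Ω] [HasOuterApproxClosed Ω] [OpensMeasurableSpace Ω]
    {L : Filter ι} [L.NeBot] {μs : ι → Measure Ω} {μ : Measure Ω}
    [∀ i, IsFiniteMeasure (μs i)] [IsFiniteMeasure μ]
    (h : ∀ f : Ω →ᵇ ℝ, Tendsto (fun i ↦ ∫ y, f y ∂(μs i)) L (𝓝 (∫ y, f y ∂μ)))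
    {F : Set Ω} (hF : IsClosed F) {c : ENNReal} (hc : ∀ᶠ i in L, c ≤ μs i F) :
    c ≤ μ F := by
  let νs : ι → FiniteMeasure Ω := fun i ↦ ⟨μs i, inferInstance⟩
  let ν : FiniteMeasure Ω := ⟨μ, inferInstance⟩
  have hlim : Tendsto νs L (𝓝 ν) :=
    FiniteMeasure.tendsto_of_forall_integral_tendsto h
  exact (le_limsup_of_frequently_le hc.frequently).trans
    (FiniteMeasure.limsup_measure_closed_le_of_tendsto hlim hF)

/-- Persistence of lower density bounds under weak convergence of measures: if finite
Borel measures `μ_i ⇀ μ` weakly (testing against bounded continuous functions), points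
`x_i → x`, and `r^{p-m} μ_i(B_r(x_i)) > ε` for all `i` and all `r ∈ (0,1)`, then
`r^{p-m} μ(B_r(x)) ≥ ε` for all `r ∈ (0,1)`. -/
theorem density_lower_bound_persists_weak_limit
    (m : ℕ) (hm : 1 ≤ m) (p : ℝ) (hpm : p ≤ (m : ℝ)) (ε : ℝ) (hε : 0 < ε)
    (μ : ℕ → Measure (EuclideanSpace ℝ (Fin m)))
    (μlim : Measure (EuclideanSpace ℝ (Fin m)))
    [∀ i, IsFiniteMeasure (μ i)] [IsFiniteMeasure μlim]
    (hweak : ∀ φ : EuclideanSpace ℝ (Fin m) → ℝ, Continuous φ →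
      (∃ M : ℝ, ∀ x, |φ x| ≤ M) →
      Filter.Tendsto (fun i => ∫ x, φ x ∂(μ i)) Filter.atTop (nhds (∫ x, φ x ∂μlim)))
    (xs : ℕ → EuclideanSpace ℝ (Fin m)) (x : EuclideanSpace ℝ (Fin m))
    (hxs : Filter.Tendsto xs Filter.atTop (nhds x))
    (hlower : ∀ i, ∀ r ∈ Set.Ioo (0 : ℝ) 1,
      ε < r ^ (p - (m : ℝ)) * (μ i (Metric.ball (xs i) r)).toReal) :
    ∀ r ∈ Set.Ioo (0 : ℝ) 1,
      ε ≤ r ^ (p - (m : ℝ)) * (μlim (Metric.ball x r)).toReal := by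
  intro r hr
  have hbound : ∀ s ∈ Set.Ioo 0 r,
      ε ≤ s ^ (p - (m : ℝ)) * (μlim (Metric.ball x r)).toReal := by
    intro s hs
    have hpos : 0 < s ^ (p - (m : ℝ)) := Real.rpow_pos_of_pos hs.1 _
    have hclosed : ENNReal.ofReal (ε / s ^ (p - (m : ℝ))) ≤
        μlim (Metric.closedBall x ((s + r) / 2)) := by
      refine le_measure_isClosed_of_forall_tendsto_integral (L := Filter.atTop) (μs := μ)
        (fun f ↦ hweak f f.continuous ⟨‖f‖, f.norm_coe_le_norm⟩) Metric.isClosed_closedBall ?_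
      filter_upwards [hxs (Metric.ball_mem_nhds x (half_pos (sub_pos.2 hs.2)))] with i hi
      have hdist : dist (xs i) x < (r - s) / 2 := hi
      have hmass := (div_lt_iff₀' hpos).2 (hlower i s ⟨hs.1, hs.2.trans hr.2⟩)
      calc ENNReal.ofReal (ε / s ^ (p - (m : ℝ)))
          ≤ μ i (Metric.ball (xs i) s) :=
            ENNReal.ofReal_le_of_le_toReal hmass.le
        _ ≤ μ i (Metric.closedBall x ((s + r) / 2)) :=
            measure_mono (Metric.ball_subset_closedBall.trans
              (Metric.closedBall_subset_closedBall' (by linarith)))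
    have hball : ENNReal.ofReal (ε / s ^ (p - (m : ℝ))) ≤ μlim (Metric.ball x r) :=
      hclosed.trans (measure_mono (Metric.closedBall_subset_ball (by linarith [hs.2])))
    exact (div_le_iff₀' hpos).1
      ((ENNReal.ofReal_le_iff_le_toReal (measure_ne_top _ _)).1 hball)
  have hcont : Filter.Tendsto
      (fun s : ℝ ↦ s ^ (p - (m : ℝ)) * (μlim (Metric.ball x r)).toReal)
      (nhdsWithin r (Set.Iio r)) (nhds (r ^ (p - (m : ℝ)) * (μlim (Metric.ball x r)).toReal)) :=
    ((Real.continuousAt_rpow_const r _ (Or.inl hr.1.ne')).mul_const _).tendsto.mono_left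
      nhdsWithin_le_nhds
  exact ge_of_tendsto hcont (Filter.mem_of_superset (Ioo_mem_nhdsLT hr.1) hbound)
end

section
/- Let m ≥ 1 be an integer, d ∈ ℝ, and let μ be a locally finite Borel measure on ℝ^m. For y ∈ ℝ^m and λ > 0 define the rescaled measure μ_{y,λ} by μ_{y,λ}(A) = λ^{−d} μ({ y + λ•a : a ∈ A }) for Borel sets A. Define the invariant set S = { y ∈ ℝ^m : μ_{y,λ} = μ for every λ > 0 }. Suppose 0 ∈ S. Then S is a linear subspace of ℝ^m, and μ is invariant under translations by elements of S: μ({ a + y : a ∈ A }) = μ(A) for every y ∈ S and every Borel set A. -/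
open MeasureTheory

theorem measurableSet_image_add_smul {E : Type*} [NormedAddCommGroup E] [NormedSpace ℝ E]
    [MeasurableSpace E] [BorelSpace E] (y : E) {l : ℝ} (hl : l ≠ 0) {A : Set E}
    (hA : MeasurableSet A) : MeasurableSet ((fun a => y + l • a) '' A) :=
  let e := (Homeomorph.smulOfNeZero l hl).trans (Homeomorph.addLeft y)
  e.measurableEmbedding.measurableSet_image.2 hA

/-- Cone splitting for homogeneous measures: let `μ` be a locally finite Borel measure on
`ℝ^m`, and for `y ∈ ℝ^m`, `λ > 0` let `μ_{y,λ}(A) = λ^{-d} μ(y + λ•A)`.  Let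
`S = {y : μ_{y,λ} = μ for all λ > 0}` be the invariant set.  If `0 ∈ S`, then `S` is a
linear subspace of `ℝ^m` and `μ` is invariant under translations by elements of `S`. -/
theorem invariant_set_is_subspace_and_translation_invariant
    (m : ℕ) (hm : 1 ≤ m) (d : ℝ)
    (μ : Measure (EuclideanSpace ℝ (Fin m))) [IsLocallyFiniteMeasure μ]
    (S : Set (EuclideanSpace ℝ (Fin m)))
    (hS : S = {y : EuclideanSpace ℝ (Fin m) |
      ∀ l : ℝ, 0 < l → ∀ A : Set (EuclideanSpace ℝ (Fin m)), MeasurableSet A →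
        μ ((fun a => y + l • a) '' A) = ENNReal.ofReal (l ^ d) * μ A})
    (h0 : (0 : EuclideanSpace ℝ (Fin m)) ∈ S) :
    (∃ V : Submodule ℝ (EuclideanSpace ℝ (Fin m)), (V : Set (EuclideanSpace ℝ (Fin m))) = S) ∧
      ∀ y ∈ S, ∀ A : Set (EuclideanSpace ℝ (Fin m)), MeasurableSet A →
        μ ((fun a => a + y) '' A) = μ A := by
  have image_comp (y z : EuclideanSpace ℝ (Fin m)) (l k : ℝ)
      (A : Set (EuclideanSpace ℝ (Fin m))) :
      (fun a => y + l • a) '' ((fun a => z + k • a) '' A) =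
        (fun a => (y + l • z) + (l * k) • a) '' A := by
    simp only [Set.image_image, smul_add, smul_smul, add_assoc]
  have mem_iff (y : EuclideanSpace ℝ (Fin m)) : y ∈ S ↔
      ∀ A, MeasurableSet A → μ ((fun a => y + (1 : ℝ) • a) '' A) = μ A := by
    rw [hS] at h0 ⊢
    constructor
    · intro h A hA
      simpa only [Real.one_rpow, ENNReal.ofReal_one, one_mul] using h 1 one_pos A hA
    · intro h l hl A hA
      rw [← h0 l hl A hA, ← h _ (measurableSet_image_add_smul 0 hl.ne' hA), image_comp]
      simp only [smul_zero, add_zero, one_mul]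
  have neg_mem {y : EuclideanSpace ℝ (Fin m)} (hy : y ∈ S) : -y ∈ S := by
    rw [mem_iff] at hy ⊢
    intro A hA
    rw [← hy _ (measurableSet_image_add_smul _ one_ne_zero hA), image_comp]
    simp
  have pos_smul_mem {y : EuclideanSpace ℝ (Fin m)} (hy : y ∈ S) {l : ℝ} (hl : 0 < l) :
      l • y ∈ S := by
    rw [mem_iff] at hy ⊢
    intro A hA
    have hdil := h0
    rw [hS] at hdil
    have hB := measurableSet_image_add_smul 0 (inv_ne_zero hl.ne') hA
    have h1 := hdil l hl _ (measurableSet_image_add_smul y one_ne_zero hB)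
    rw [hy _ hB, ← hdil l hl _ hB] at h1
    simpa [Set.image_image, smul_smul, hl.ne'] using h1
  refine ⟨⟨{ carrier := S, zero_mem' := h0, add_mem' := ?_, smul_mem' := ?_ }, rfl⟩, ?_⟩
  · intro y z hy hz
    rw [mem_iff] at hy hz ⊢
    intro A hA
    rw [← hz A hA, ← hy _ (measurableSet_image_add_smul z one_ne_zero hA), image_comp]
    simp only [one_smul, one_mul]
  · intro l y hy
    rcases lt_trichotomy l 0 with hl | rfl | hl
    · simpa only [smul_neg, neg_smul, neg_neg] using pos_smul_mem (neg_mem hy) (neg_pos.2 hl)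
    · simpa only [zero_smul] using h0
    · exact pos_smul_mem hy hl
  · intro y hy A hA
    simpa only [one_smul, add_comm y] using (mem_iff y).1 hy A hA
end
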